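/- arXiv:1105.3853 — 6 statements merged into one kernel-verified Lean document; each statement's English description precedes it below -/
import Mathlib

section
/- For every formula F, CL15 ⊢ ⫰¬F ∨ F (i.e., the formula ⊓F → F is provable in CL15). -/
/-! ### Formulas -/

/-- Formulas of CL15, in negation normal form: literals over the atoms, parallel
conjunction/disjunction, branching recurrence `⊓` and branching corecurrence `⫰`. -/
inductive Formula (Atom : Type) : Type
  | pos (a : Atom)
  | nega (a : Atom)
  | and (F G : Formula Atom)
  | or (F G : Formula Atom)
  | brec (F : Formula Atom)
  | cobrec (F : Formula Atom)

namespace Formula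

/-- Negation `¬F`, extended from atoms to all formulas via the De Morgan laws. -/
def not {Atom : Type} : Formula Atom → Formula Atom
  | pos a => nega a
  | nega a => pos a
  | and F G => or F.not G.not
  | or F G => and F.not G.not
  | brec F => cobrec F.not
  | cobrec F => brec F.not

end Formula

/-! ### Cirquents -/

/-- A cirquent: a (nonempty) finite sequence of oformulas together with (nonempty) finite
sequences of undergroups and overgroups;  groups are recorded as sets of positions
(0-based indices) of oformulas. -/
structure Cirquent (Atom : Type) : Type where
  ofs : List (Formula Atom)
  ugs : List (Set ℕ)
  ogs : List (Set ℕ)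

/-- Well-formedness of a cirquent: the sequences of oformulas, undergroups and overgroups
are nonempty, each group is a nonempty set of positions of oformulas, and every oformula
belongs to at least one undergroup and at least one overgroup. -/
def Cirquent.WF {Atom : Type} (C : Cirquent Atom) : Prop :=
  C.ofs ≠ [] ∧ C.ugs ≠ [] ∧ C.ogs ≠ [] ∧
  (∀ S ∈ C.ugs, S.Nonempty ∧ ∀ i ∈ S, i < C.ofs.length) ∧
  (∀ S ∈ C.ogs, S.Nonempty ∧ ∀ i ∈ S, i < C.ofs.length) ∧
  (∀ i, i < C.ofs.length → (∃ S ∈ C.ugs, i ∈ S) ∧ (∃ S ∈ C.ogs, i ∈ S))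

/-- Re-indexing of a group when the two adjacent oformulas at positions `a`, `a+1`
are swapped. -/
def swapSet (a : ℕ) (S : Set ℕ) : Set ℕ :=
  {i | (i = a ∧ a + 1 ∈ S) ∨ (i = a + 1 ∧ a ∈ S) ∨ (i ≠ a ∧ i ≠ a + 1 ∧ i ∈ S)}

/-- Re-indexing of a group when the oformula at position `a` is replaced by two adjacent
oformulas (at positions `a` and `a+1`), kept in the same groups. -/
def dupSet (a : ℕ) (S : Set ℕ) : Set ℕ :=
  {i | (i < a ∧ i ∈ S) ∨ ((i = a ∨ i = a + 1) ∧ a ∈ S) ∨ (a + 1 < i ∧ i - 1 ∈ S)}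

/-- Re-indexing of a group when the oformula at position `a` is deleted. -/
def delSet (a : ℕ) (S : Set ℕ) : Set ℕ :=
  {i | (i < a ∧ i ∈ S) ∨ (a ≤ i ∧ i + 1 ∈ S)}

open Classical in
/-- Delete the empty groups from a list of groups. -/
noncomputable def removeEmpty : List (Set ℕ) → List (Set ℕ)
  | [] => []
  | S :: l => if S = ∅ then removeEmpty l else S :: removeEmpty l

/-- The axioms of CL15: for formulas `F1, …, Fn` (`n ≥ 1`), the cirquent with oformulas
`¬F1, F1, …, ¬Fn, Fn` whose undergroups and overgroups are both
`{¬F1,F1}, …, {¬Fn,Fn}`. -/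
def IsAxiom {Atom : Type} (C : Cirquent Atom) : Prop :=
  ∃ Fs : List (Formula Atom), Fs ≠ [] ∧
    C.ofs = Fs.flatMap (fun F => [F.not, F]) ∧
    C.ugs = (List.range Fs.length).map (fun i => ({2 * i, 2 * i + 1} : Set ℕ)) ∧
    C.ogs = (List.range Fs.length).map (fun i => ({2 * i, 2 * i + 1} : Set ℕ))

/-- Undergroup Exchange: `B` is obtained from `A` by swapping two adjacent undergroups. -/
def UnderExchangeRel {Atom : Type} (A B : Cirquent Atom) : Prop :=
  A.ofs = B.ofs ∧ A.ogs = B.ogs ∧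
  ∃ (l1 l2 : List (Set ℕ)) (u v : Set ℕ),
    A.ugs = l1 ++ [u, v] ++ l2 ∧ B.ugs = l1 ++ [v, u] ++ l2

/-- Undergroup Duplication: `B` is obtained from `A` by replacing an undergroup with two
adjacent undergroups with the same content. -/
def UnderDupRel {Atom : Type} (A B : Cirquent Atom) : Prop :=
  A.ofs = B.ofs ∧ A.ogs = B.ogs ∧
  ∃ (l1 l2 : List (Set ℕ)) (U : Set ℕ),
    A.ugs = l1 ++ [U] ++ l2 ∧ B.ugs = l1 ++ [U, U] ++ l2

open Classical in
/-- The rules of CL15 (other than Axiom): `Rule A B` means that conclusion `B` follows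
from premise `A` by one of the rules. -/
inductive Rule {Atom : Type} : Cirquent Atom → Cirquent Atom → Prop
  /-- Undergroup Exchange. -/
  | underExch (ofs : List (Formula Atom)) (l1 l2 : List (Set ℕ)) (u v : Set ℕ) (ogs) :
      Rule ⟨ofs, l1 ++ [u, v] ++ l2, ogs⟩ ⟨ofs, l1 ++ [v, u] ++ l2, ogs⟩
  /-- Overgroup Exchange. -/
  | overExch (ofs : List (Formula Atom)) (ugs) (l1 l2 : List (Set ℕ)) (u v : Set ℕ) :
      Rule ⟨ofs, ugs, l1 ++ [u, v] ++ l2⟩ ⟨ofs, ugs, l1 ++ [v, u] ++ l2⟩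
  /-- Oformula Exchange. -/
  | ofExch (l1 l2 : List (Formula Atom)) (E F : Formula Atom) (ugs ogs : List (Set ℕ)) :
      Rule ⟨l1 ++ [E, F] ++ l2, ugs.map (swapSet l1.length), ogs.map (swapSet l1.length)⟩
           ⟨l1 ++ [F, E] ++ l2, ugs, ogs⟩
  /-- Weakening, the case where only an arc is deleted. -/
  | weakenArc (ofs : List (Formula Atom)) (l1 l2 : List (Set ℕ)) (U : Set ℕ) (a : ℕ)
      (ha : a ∈ U) (b : ℕ) (hb : b ∈ U) (hab : b ≠ a)
      (hother : ∃ V ∈ l1 ++ l2, a ∈ V) (ogs : List (Set ℕ)) :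
      Rule ⟨ofs, l1 ++ [U \ {a}] ++ l2, ogs⟩ ⟨ofs, l1 ++ [U] ++ l2, ogs⟩
  /-- Weakening, the case where the oformula is deleted together with the arc. -/
  | weakenDel (ofs : List (Formula Atom)) (l1 l2 : List (Set ℕ)) (U : Set ℕ) (a : ℕ)
      (ha : a ∈ U) (b : ℕ) (hb : b ∈ U) (hab : b ≠ a) (halen : a < ofs.length)
      (honly : ∀ V ∈ l1 ++ l2, a ∉ V) (ogs : List (Set ℕ)) :
      Rule ⟨ofs.eraseIdx a, (l1 ++ [U \ {a}] ++ l2).map (delSet a),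
            removeEmpty (ogs.map (delSet a))⟩
           ⟨ofs, l1 ++ [U] ++ l2, ogs⟩
  /-- Contraction. -/
  | contraction (l1 l2 : List (Formula Atom)) (F : Formula Atom) (ugs ogs : List (Set ℕ)) :
      Rule ⟨l1 ++ [.cobrec F, .cobrec F] ++ l2,
            ugs.map (dupSet l1.length), ogs.map (dupSet l1.length)⟩
           ⟨l1 ++ [.cobrec F] ++ l2, ugs, ogs⟩
  /-- Undergroup Duplication. -/
  | underDup (ofs : List (Formula Atom)) (l1 l2 : List (Set ℕ)) (U : Set ℕ) (ogs) :
      Rule ⟨ofs, l1 ++ [U] ++ l2, ogs⟩ ⟨ofs, l1 ++ [U, U] ++ l2, ogs⟩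
  /-- Overgroup Duplication. -/
  | overDup (ofs : List (Formula Atom)) (ugs) (l1 l2 : List (Set ℕ)) (O : Set ℕ) :
      Rule ⟨ofs, ugs, l1 ++ [O] ++ l2⟩ ⟨ofs, ugs, l1 ++ [O, O] ++ l2⟩
  /-- Merging. -/
  | merging (ofs : List (Formula Atom)) (ugs) (l1 l2 : List (Set ℕ)) (O1 O2 : Set ℕ) :
      Rule ⟨ofs, ugs, l1 ++ [O1, O2] ++ l2⟩ ⟨ofs, ugs, l1 ++ [O1 ∪ O2] ++ l2⟩
  /-- Disjunction Introduction. -/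
  | disjIntro (l1 l2 : List (Formula Atom)) (F G : Formula Atom) (ugs ogs : List (Set ℕ)) :
      Rule ⟨l1 ++ [F, G] ++ l2, ugs.map (dupSet l1.length), ogs.map (dupSet l1.length)⟩
           ⟨l1 ++ [.or F G] ++ l2, ugs, ogs⟩
  /-- Conjunction Introduction. -/
  | conjIntro (l1 l2 : List (Formula Atom)) (F G : Formula Atom) (ugs ogs : List (Set ℕ)) :
      Rule ⟨l1 ++ [F, G] ++ l2,
            ugs.flatMap (fun U =>
              if l1.length ∈ U
              then [dupSet l1.length U \ {l1.length + 1}, dupSet l1.length U \ {l1.length}]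
              else [dupSet l1.length U]),
            ogs.map (dupSet l1.length)⟩
           ⟨l1 ++ [.and F G] ++ l2, ugs, ogs⟩
  /-- Recurrence Introduction. -/
  | recIntro (l1 l2 : List (Formula Atom)) (F : Formula Atom) (ugs : List (Set ℕ))
      (g1 g2 : List (Set ℕ)) :
      Rule ⟨l1 ++ [F] ++ l2, ugs, g1 ++ [{l1.length}] ++ g2⟩
           ⟨l1 ++ [.brec F] ++ l2, ugs, g1 ++ g2⟩
  /-- Corecurrence Introduction. -/
  | corecIntro (l1 l2 : List (Formula Atom)) (F : Formula Atom) (ugs : List (Set ℕ))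
      (ogsA ogsB : List (Set ℕ))
      (h : List.Forall₂ (fun OB OA => OB ⊆ OA ∧ OA ⊆ OB ∪ {l1.length}) ogsB ogsA) :
      Rule ⟨l1 ++ [F] ++ l2, ugs, ogsA⟩ ⟨l1 ++ [.cobrec F] ++ l2, ugs, ogsB⟩

/-- Provability in CL15: a cirquent is provable iff there is a finite sequence of
(well-formed) cirquents ending in it, starting with an axiom, in which every subsequent
cirquent follows from the immediately preceding one by one of the rules of CL15. -/
inductive Derivable {Atom : Type} : Cirquent Atom → Prop
  | ax {C : Cirquent Atom} : IsAxiom C → C.WF → Derivable C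
  | step {A B : Cirquent Atom} : Derivable A → Rule A B → B.WF → Derivable B

/-- `CL15 ⊢ F`: the cirquent `F♣ = (⟨F⟩, ⟨{F}⟩, ⟨{F}⟩)` is provable in CL15. -/
def Provable {Atom : Type} (F : Formula Atom) : Prop :=
  Derivable (⟨[F], [{0}], [{0}]⟩ : Cirquent Atom)

theorem dupSet_zero_singleton : dupSet 0 {0} = {0, 1} := by
  ext i
  simp only [dupSet, Set.mem_ofPred_eq, Set.mem_singleton_iff, Set.mem_insert_iff, and_true]
  omega

theorem wf_pair {Atom : Type} (F G : Formula Atom) :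
    (⟨[F, G], [{0, 1}], [{0, 1}]⟩ : Cirquent Atom).WF := by
  simp only [Cirquent.WF, List.mem_singleton, forall_eq, exists_eq_left, Set.mem_insert_iff,
    Set.mem_singleton_iff, List.length_cons, List.length_nil]
  refine ⟨by simp, by simp, by simp, ⟨⟨0, by simp⟩, ?_⟩, ⟨⟨0, by simp⟩, ?_⟩, ?_⟩ <;> omega

theorem wf_singleton {Atom : Type} (F : Formula Atom) :
    (⟨[F], [{0}], [{0}]⟩ : Cirquent Atom).WF := by
  simp [Cirquent.WF]

theorem derivable_not_self {Atom : Type} (F : Formula Atom) :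
    Derivable (⟨[F.not, F], [{0, 1}], [{0, 1}]⟩ : Cirquent Atom) :=
  .ax ⟨[F], by simp, by simp, by simp, by simp⟩ (wf_pair _ _)

theorem derivable_cobrec_not_self {Atom : Type} (F : Formula Atom) :
    Derivable (⟨[.cobrec F.not, F], [{0, 1}], [{0, 1}]⟩ : Cirquent Atom) :=
  .step (derivable_not_self F)
    (.corecIntro [] [F] F.not _ _ _ (.cons ⟨subset_rfl, Set.subset_union_left⟩ .nil))
    (wf_pair _ _)

theorem Provable.or_of_derivable_pair {Atom : Type} {F G : Formula Atom}
    (h : Derivable (⟨[F, G], [{0, 1}], [{0, 1}]⟩ : Cirquent Atom)) : Provable (F.or G) := by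
  refine .step ?_ (.disjIntro [] [] F G [{0}] [{0}]) (wf_singleton _)
  simpa [dupSet_zero_singleton] using h

/-- For every formula `F`, `CL15 ⊢ ⫰¬F ∨ F` (i.e., the formula `⊓F → F`
is provable in CL15). -/
theorem cl15_proves_brec_implies_self (F : Formula ℕ) :
    Provable (Formula.or (Formula.cobrec F.not) F) := by
  exact Provable.or_of_derivable_pair (derivable_cobrec_not_self F)
end

section
/- For every formula F, CL15 ⊢ ⫰¬F ∨ (⊓F ∧ ⊓F) (i.e., the formula ⊓F → ⊓F∧⊓F is provable in CL15). -/
/-- The rules of CL15 applied backwards, with the premise given up to equality of its three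
sequences. -/
theorem Derivable.of_rule {Atom : Type} {fs fs' : List (Formula Atom)}
    {us us' os os' : List (Set ℕ)} {B : Cirquent Atom} (hr : Rule ⟨fs', us', os'⟩ B)
    (hB : B.WF) (hA : Derivable ⟨fs, us, os⟩) (hf : fs' = fs) (hu : us' = us) (ho : os' = os) :
    Derivable B := by
  subst hf hu ho
  exact .step hA hr hB

/-- The axiom for `¬F, F, ¬F, F`. -/
theorem derivable_axiom_pair {Atom : Type} (F : Formula Atom) :
    Derivable ⟨[F.not, F, F.not, F], [{0, 1}, {2, 3}], [{0, 1}, {2, 3}]⟩ := by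
  refine .ax ⟨[F, F], by simp, by simp, by simp [List.range_succ], by simp [List.range_succ]⟩ ?_
  simp [Cirquent.WF]
  grind

/-- Duplicating and merging the overgroups of the axiom adds an overgroup containing all four
oformulas. -/
theorem derivable_merged_pair {Atom : Type} (F : Formula Atom) :
    Derivable ⟨[F.not, F, F.not, F], [{0, 1}, {2, 3}], [{0, 1, 2, 3}, {0, 1}, {2, 3}]⟩ := by
  have h : ({0, 1, 2, 3} : Set ℕ) = {0, 1} ∪ {2, 3} := by grind
  rw [h]
  refine .step (.step (.step (.step (derivable_axiom_pair F)
    (.overDup _ _ [] [{2, 3}] {0, 1}) ?_)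
    (.overDup _ _ [{0, 1}, {0, 1}] [] {2, 3}) ?_)
    (.overExch _ _ [{0, 1}] [{2, 3}] {0, 1} {2, 3}) ?_)
    (.merging _ _ [] [{0, 1}, {2, 3}] {0, 1} {2, 3}) ?_
  all_goals
    simp [Cirquent.WF]
    grind

/-- Both recurrences and both corecurrences introduced. -/
theorem derivable_cobrec_brec_pair {Atom : Type} (F : Formula Atom) :
    Derivable ⟨[.cobrec F.not, .brec F, .cobrec F.not, .brec F], [{0, 1}, {2, 3}],
      [{0, 1, 2, 3}]⟩ := by
  refine .step (.step (.step (.step (derivable_merged_pair F)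
    (.corecIntro [F.not, F] [F] F.not _ _ [{0, 1, 2, 3}, {0, 1}, {3}] ?_) ?_)
    (.corecIntro [] [F, .cobrec F.not, F] F.not _ _ [{0, 1, 2, 3}, {1}, {3}] ?_) ?_)
    (.recIntro [.cobrec F.not, F, .cobrec F.not] [] F _ [{0, 1, 2, 3}, {1}] []) ?_)
    (.recIntro [.cobrec F.not] [.cobrec F.not, .brec F] F _ [{0, 1, 2, 3}] []) ?_
  all_goals
    simp [Cirquent.WF]
    try grind

/-- For every formula `F`, `CL15 ⊢ ⫰¬F ∨ (⊓F ∧ ⊓F)` (i.e., the formula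
`⊓F → ⊓F∧⊓F` is provable in CL15). -/
theorem cl15_proves_brec_contraction (F : Formula ℕ) :
    Provable (Formula.or (Formula.cobrec F.not)
      (Formula.and (Formula.brec F) (Formula.brec F))) := by
  have hexch : Derivable ⟨[.cobrec F.not, .cobrec F.not, .brec F, .brec F],
      [{0, 2}, {1, 3}], [{0, 1, 2, 3}]⟩ := by
    refine .of_rule (.ofExch [.cobrec F.not] [.brec F] (.brec F) (.cobrec F.not) _ _) ?_
      (derivable_cobrec_brec_pair F) rfl ?_ ?_
    · simp [Cirquent.WF]
      grind
    all_goals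
      simp [swapSet, Set.ext_iff]
      grind
  have hweak₁ : Derivable ⟨[.cobrec F.not, .cobrec F.not, .brec F, .brec F],
      [{0, 2}, {0, 1, 3}], [{0, 1, 2, 3}]⟩ := by
    refine .of_rule (.weakenArc _ [{0, 2}] [] {0, 1, 3} 0 (by simp) 1 (by simp) (by simp)
      (by simp) _) ?_ hexch rfl ?_ rfl
    · simp [Cirquent.WF]
      grind
    · simp
  have hweak₂ : Derivable ⟨[.cobrec F.not, .cobrec F.not, .brec F, .brec F],
      [{0, 1, 2}, {0, 1, 3}], [{0, 1, 2, 3}]⟩ := by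
    refine .of_rule (.weakenArc _ [] [{0, 1, 3}] {0, 1, 2} 1 (by simp) 0 (by simp) (by simp)
      (by simp) _) ?_ hweak₁ rfl ?_ rfl
    · simp [Cirquent.WF]
      grind
    · simp [Set.ext_iff]
      grind
  have hcontr : Derivable ⟨[.cobrec F.not, .brec F, .brec F],
      [{0, 1}, {0, 2}], [{0, 1, 2}]⟩ := by
    refine .of_rule (.contraction [] [.brec F, .brec F] F.not _ _) ?_ hweak₂ rfl ?_ ?_
    · simp [Cirquent.WF]
      grind
    all_goals
      simp [dupSet, Set.ext_iff]
      grind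
  have hconj : Derivable ⟨[.cobrec F.not, .and (.brec F) (.brec F)],
      [{0, 1}], [{0, 1}]⟩ := by
    refine .of_rule (.conjIntro [.cobrec F.not] [] (.brec F) (.brec F) _ _) ?_ hcontr rfl ?_ ?_
    · simp [Cirquent.WF]
      grind
    all_goals
      simp [dupSet, Set.ext_iff]
      grind
  refine .of_rule (.disjIntro [] [] (.cobrec F.not) (.and (.brec F) (.brec F)) _ _) ?_ hconj
    rfl ?_ ?_
  · simp [Cirquent.WF]
  all_goals
    simp [dupSet, Set.ext_iff]
    grind
end

section
/- For every formula F, CL15 ⊢ ⫰¬F ∨ ⊓⊓F (i.e., the formula ⊓F → ⊓⊓F is provable in CL15). -/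
theorem Cirquent.WF.pair {Atom : Type} {A B : Formula Atom} {ogs : List (Set ℕ)}
    (h : ∀ S ∈ ogs, S.Nonempty ∧ ∀ i ∈ S, i < 2) :
    (⟨[A, B], [{0, 1}], {0, 1} :: ogs⟩ : Cirquent Atom).WF := by
  have mem_pair (i : ℕ) (hi : i < 2) : i ∈ ({0, 1} : Set ℕ) := by
    simp only [Set.mem_insert_iff, Set.mem_singleton_iff]
    omega
  refine ⟨by simp, by simp, by simp, by simp, ?_, fun i hi => ?_⟩
  · simpa using h
  · exact ⟨⟨_, List.mem_cons_self, mem_pair i hi⟩, _, List.mem_cons_self, mem_pair i hi⟩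

/-- For every formula `F`, `CL15 ⊢ ⫰¬F ∨ ⊓⊓F` (i.e., the formula
`⊓F → ⊓⊓F` is provable in CL15). -/
theorem cl15_proves_brec_implies_brec_brec (F : Formula ℕ) :
    Provable (Formula.or (Formula.cobrec F.not) (Formula.brec (Formula.brec F))) := by
  have identity : Derivable (⟨[F.not, F], [{0, 1}], [{0, 1}]⟩ : Cirquent ℕ) :=
    .ax ⟨[F], by simp, by simp, by simp, by simp⟩ (.pair (by simp))
  have twoOvergroups :
      Derivable (⟨[F.not, F], [{0, 1}], [{0, 1}, {0, 1}]⟩ : Cirquent ℕ) :=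
    .step identity (.overDup _ _ [] [] {0, 1}) (.pair (by simp))
  have threeOvergroups :
      Derivable (⟨[F.not, F], [{0, 1}], [{0, 1}, {0, 1}, {0, 1}]⟩ : Cirquent ℕ) :=
    .step twoOvergroups (.overDup _ _ [] [{0, 1}] {0, 1}) (.pair (by simp))
  have corecurrence :
      Derivable (⟨[.cobrec F.not, F], [{0, 1}], [{0, 1}, {1}, {1}]⟩ : Cirquent ℕ) :=
    .step threeOvergroups
      (.corecIntro [] [F] F.not _ _ _ (by simp)) (.pair (by simp))
  have recurrence :
      Derivable (⟨[.cobrec F.not, .brec F], [{0, 1}], [{0, 1}, {1}]⟩ : Cirquent ℕ) :=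
    .step corecurrence (.recIntro [.cobrec F.not] [] F _ [{0, 1}] [{1}]) (.pair (by simp))
  have doubleRecurrence :
      Derivable (⟨[.cobrec F.not, .brec (.brec F)], [{0, 1}], [{0, 1}]⟩ : Cirquent ℕ) :=
    .step recurrence (.recIntro [.cobrec F.not] [] (.brec F) _ [{0, 1}] []) (.pair (by simp))
  have disjunction := Rule.disjIntro [] [] (.cobrec F.not) (.brec (.brec F)) [{0}] [{0}]
  simp only [List.length_nil, List.map_cons, List.map_nil, dupSet_zero_singleton] at disjunction
  exact .step doubleRecurrence disjunction (by simp [Cirquent.WF])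
end

section
/- For all formulas E and F, CL15 ⊢ (⫰¬E ∧ ⫰¬F) ∨ ⊓(E∨F) (i.e., the formula ⊓E∨⊓F → ⊓(E∨F) is provable in CL15). -/
/-- Apply a rule to a derivable cirquent presented in a form equal to the premise. -/
theorem Derivable.step_of_eq {Atom : Type} {A A' B : Cirquent Atom} (hA : Derivable A)
    (hR : Rule A' B) (hEq : A = A') (hB : B.WF) : Derivable B :=
  .step hA (hEq ▸ hR) hB

/-- Well-formedness without the redundant requirement that the lists of groups be nonempty,
which follows from the groups covering the oformulas. -/
theorem Cirquent.WF.of_cover {Atom : Type} {C : Cirquent Atom} (hpos : C.ofs ≠ [])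
    (hug : ∀ S ∈ C.ugs, S.Nonempty ∧ ∀ i ∈ S, i < C.ofs.length)
    (hog : ∀ S ∈ C.ogs, S.Nonempty ∧ ∀ i ∈ S, i < C.ofs.length)
    (hcov : ∀ i, i < C.ofs.length → (∃ S ∈ C.ugs, i ∈ S) ∧ (∃ S ∈ C.ogs, i ∈ S)) :
    C.WF := by
  obtain ⟨⟨S, hS, -⟩, ⟨T, hT, -⟩⟩ := hcov 0 (List.length_pos_of_ne_nil hpos)
  exact ⟨hpos, List.ne_nil_of_mem hS, List.ne_nil_of_mem hT, hug, hog, hcov⟩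

/-- The cirquent with oformulas `¬E, ¬F, E, F`, undergroups `{¬E, E}, {¬F, F}` and a single
overgroup containing all oformulas is derivable. -/
theorem derivable_not_not_pair {Atom : Type} (E F : Formula Atom) :
    Derivable ⟨[E.not, F.not, E, F], [{0, 2}, {1, 3}], [{0, 1, 2, 3}]⟩ := by
  have axiom_pair : Derivable
      ⟨[E.not, E, F.not, F], [{0, 1}, {2, 3}], [{0, 1}, {2, 3}]⟩ := by
    refine .ax ⟨[E, F], by simp, by simp, by simp [List.range_succ], by simp [List.range_succ]⟩ ?_
    refine .of_cover (by simp) (by simp) (by simp) ?_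
    simp only [List.length_cons, List.length_nil, List.mem_cons, List.not_mem_nil]
    intro i hi
    interval_cases i <;> simp
  have exchanged : Derivable
      ⟨[E.not, F.not, E, F], [{0, 2}, {1, 3}], [{0, 2}, {1, 3}]⟩ := by
    refine axiom_pair.step_of_eq (.ofExch [E.not] [F] E F.not _ _) ?_ ?_
    · simp only [List.map_cons, List.map_nil, Cirquent.mk.injEq, List.cons.injEq, and_true]
      refine ⟨rfl, ⟨?_, ?_⟩, ?_, ?_⟩ <;> ext i <;> simp [swapSet] <;> omega
    · refine .of_cover (by simp) (by simp) (by simp) ?_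
      simp only [List.length_cons, List.length_nil, List.mem_cons, List.not_mem_nil]
      intro i hi
      interval_cases i <;> simp
  have hunion : ({0, 1, 2, 3} : Set ℕ) = {0, 2} ∪ {1, 3} := by ext i; simp; omega
  rw [hunion]
  refine exchanged.step (.merging _ _ [] [] _ _) ?_
  refine .of_cover (by simp) (by simp) (by simp) ?_
  simp only [List.length_cons, List.length_nil, List.mem_cons, List.not_mem_nil]
  intro i hi
  interval_cases i <;> simp

/-- Weakening and corecurrence introduction applied to `derivable_not_not_pair`. -/
theorem derivable_cobrec_cobrec_pair {Atom : Type} (E F : Formula Atom) :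
    Derivable ⟨[.cobrec E.not, .cobrec F.not, E, F], [{0, 2, 3}, {1, 2, 3}],
      [{0, 1, 2, 3}, {2, 3}]⟩ := by
  have duplicated : Derivable ⟨[E.not, F.not, E, F], [{0, 2}, {1, 3}],
      [{0, 1, 2, 3}, {0, 1, 2, 3}]⟩ := by
    refine (derivable_not_not_pair E F).step (.overDup _ _ [] [] _) ?_
    refine .of_cover (by simp) (by simp) (by simp) ?_
    simp only [List.length_cons, List.length_nil, List.mem_cons, List.not_mem_nil]
    intro i hi
    interval_cases i <;> simp
  have weakened_left : Derivable ⟨[E.not, F.not, E, F], [{0, 2, 3}, {1, 3}],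
      [{0, 1, 2, 3}, {0, 1, 2, 3}]⟩ := by
    refine duplicated.step_of_eq
      (.weakenArc _ [] [{1, 3}] {0, 2, 3} 3 (by simp) 0 (by simp) (by simp) (by simp) _) ?_ ?_
    · simp only [List.nil_append, List.cons_append, Cirquent.mk.injEq, List.cons.injEq, and_true,
        true_and]
      ext i; simp; omega
    · refine .of_cover (by simp) (by simp) (by simp) ?_
      simp only [List.length_cons, List.length_nil]
      intro i hi
      interval_cases i <;> simp
  have weakened : Derivable ⟨[E.not, F.not, E, F], [{0, 2, 3}, {1, 2, 3}],
      [{0, 1, 2, 3}, {0, 1, 2, 3}]⟩ := by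
    refine weakened_left.step_of_eq
      (.weakenArc _ [{0, 2, 3}] [] {1, 2, 3} 2 (by simp) 1 (by simp) (by simp) (by simp) _) ?_ ?_
    · simp only [List.nil_append, List.cons_append, Cirquent.mk.injEq, List.cons.injEq, and_true,
        true_and]
      ext i; simp; omega
    · refine .of_cover (by simp) (by simp) (by simp) ?_
      simp only [List.length_cons, List.length_nil]
      intro i hi
      interval_cases i <;> simp
  have corec_right : Derivable ⟨[E.not, .cobrec F.not, E, F], [{0, 2, 3}, {1, 2, 3}],
      [{0, 1, 2, 3}, {0, 2, 3}]⟩ := by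
    refine weakened.step
      (.corecIntro [E.not] [E, F] F.not _ _ [{0, 1, 2, 3}, {0, 2, 3}] ?_) ?_
    · refine .cons ?_ (.cons ?_ .nil) <;> constructor <;> intro i <;> simp <;> omega
    · refine .of_cover (by simp) (by simp) (by simp) ?_
      simp only [List.length_cons, List.length_nil]
      intro i hi
      interval_cases i <;> simp
  refine corec_right.step
    (.corecIntro [] [.cobrec F.not, E, F] E.not _ _ [{0, 1, 2, 3}, {2, 3}] ?_) ?_
  · refine .cons ?_ (.cons ?_ .nil) <;> constructor <;> intro i <;> simp; omega
  · refine .of_cover (by simp) (by simp) (by simp) ?_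
    simp only [List.length_cons, List.length_nil]
    intro i hi
    interval_cases i <;> simp

/-- For all formulas `E` and `F`,
`CL15 ⊢ (⫰¬E ∧ ⫰¬F) ∨ ⊓(E∨F)` (i.e., the formula `⊓E∨⊓F → ⊓(E∨F)` is provable
in CL15). -/
theorem cl15_proves_brec_or (E F : Formula ℕ) :
    Provable (Formula.or (Formula.and (Formula.cobrec E.not) (Formula.cobrec F.not))
      (Formula.brec (Formula.or E F))) := by
  have disj_inner : Derivable ⟨[.cobrec E.not, .cobrec F.not, .or E F], [{0, 2}, {1, 2}],
      [{0, 1, 2}, {2}]⟩ := by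
    refine (derivable_cobrec_cobrec_pair E F).step_of_eq
      (.disjIntro [.cobrec E.not, .cobrec F.not] [] E F _ _) ?_ ?_
    · simp only [List.map_cons, List.map_nil, Cirquent.mk.injEq, List.cons.injEq, and_true]
      refine ⟨rfl, ⟨?_, ?_⟩, ?_, ?_⟩ <;> ext i <;> simp [dupSet] <;> omega
    · refine .of_cover (by simp) (by simp) (by simp) ?_
      simp only [List.length_cons, List.length_nil]
      intro i hi
      interval_cases i <;> simp
  have conj : Derivable ⟨[.and (.cobrec E.not) (.cobrec F.not), .or E F], [{0, 1}],
      [{0, 1}, {1}]⟩ := by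
    refine disj_inner.step_of_eq
      (.conjIntro [] [.or E F] (.cobrec E.not) (.cobrec F.not) _ _) ?_ ?_
    · simp only [List.flatMap_cons, List.flatMap_nil, List.length_nil, Set.mem_insert_iff, true_or,
        if_true, List.append_nil, List.map_cons, List.map_nil, Cirquent.mk.injEq,
        List.cons.injEq, and_true]
      refine ⟨rfl, ⟨?_, ?_⟩, ?_, ?_⟩ <;> ext i <;> simp [dupSet] <;> omega
    · refine .of_cover (by simp) (by simp) (by simp) ?_
      simp only [List.length_cons, List.length_nil]
      intro i hi
      interval_cases i <;> simp
  have recurrence : Derivable ⟨[.and (.cobrec E.not) (.cobrec F.not), .brec (.or E F)], [{0, 1}],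
      [{0, 1}]⟩ := by
    refine conj.step (.recIntro [.and (.cobrec E.not) (.cobrec F.not)] [] (.or E F) _
      [{0, 1}] []) ?_
    refine .of_cover (by simp) (by simp) (by simp) ?_
    simp only [List.length_cons, List.length_nil]
    intro i hi
    interval_cases i <;> simp
  refine recurrence.step_of_eq (.disjIntro [] [] _ _ _ _) ?_ (.of_cover ?_ ?_ ?_ ?_)
  · simp only [List.map_cons, List.map_nil, Cirquent.mk.injEq, List.cons.injEq, and_true]
    refine ⟨rfl, ?_, ?_⟩ <;> ext i <;> simp [dupSet] <;> omega
  all_goals simp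
end

section
/- For every formula F, CL15 ⊢ ⊓⫰¬F ∨ ⊓⫰F (i.e., the formula ⫰⊓F → ⊓⫰F, which is not provable in affine logic, is provable in CL15). -/
/-- A cirquent with two oformulas whose only undergroup contains both of them is well-formed as
soon as its overgroups are nonempty sets of positions and one of them contains both oformulas. -/
theorem Cirquent.wf_pair {Atom : Type} (E F : Formula Atom) (ogs : List (Set ℕ))
    (h : ∀ S ∈ ogs, S.Nonempty ∧ S ⊆ {0, 1}) (hmem : {0, 1} ∈ ogs) :
    (⟨[E, F], [{0, 1}], ogs⟩ : Cirquent Atom).WF := by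
  have hlt : ∀ i ∈ ({0, 1} : Set ℕ), i < 2 := by
    rintro i (rfl | rfl) <;> decide
  have hin : ∀ i < 2, i ∈ ({0, 1} : Set ℕ) := by
    intro i hi
    simp only [Set.mem_insert_iff, Set.mem_singleton_iff]
    omega
  refine ⟨by simp, by simp, List.ne_nil_of_mem hmem, ?_, ?_, ?_⟩
  · intro S hS
    obtain rfl := List.mem_singleton.mp hS
    exact ⟨⟨0, by simp⟩, hlt⟩
  · exact fun S hS => ⟨(h S hS).1, fun i hi => hlt i ((h S hS).2 hi)⟩
  · exact fun i hi => ⟨⟨_, List.mem_singleton_self _, hin i hi⟩, ⟨_, hmem, hin i hi⟩⟩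

/-- For every formula `F`, `CL15 ⊢ ⊓⫰¬F ∨ ⊓⫰F` (i.e., the formula
`⫰⊓F → ⊓⫰F`, which is not provable in affine logic, is provable in CL15). -/
theorem cl15_proves_cobrec_brec_implies_brec_cobrec (F : Formula ℕ) :
    Provable (Formula.or (Formula.brec (Formula.cobrec F.not))
      (Formula.brec (Formula.cobrec F))) := by
  have ax : Derivable ⟨[F.not, F], [{0, 1}], [{0, 1}]⟩ :=
    .ax ⟨[F], by simp, by simp, by simp, by simp⟩ (Cirquent.wf_pair _ _ _ (by simp) (by simp))
  have dup : Derivable ⟨[F.not, F], [{0, 1}], [{0, 1}, {0, 1}]⟩ :=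
    ax.step (.overDup _ _ [] [] _) (Cirquent.wf_pair _ _ _ (by simp) (by simp))
  have dup₂ : Derivable ⟨[F.not, F], [{0, 1}], [{0, 1}, {0, 1}, {0, 1}]⟩ :=
    dup.step (.overDup _ _ [] [{0, 1}] _) (Cirquent.wf_pair _ _ _ (by simp) (by simp))
  have corec : Derivable ⟨[F.not, F.cobrec], [{0, 1}], [{0, 1}, {0}, {0, 1}]⟩ :=
    dup₂.step (.corecIntro [F.not] [] F _ _ _ (by simp [Set.insert_subset_iff]))
      (Cirquent.wf_pair _ _ _ (by simp) (by simp))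
  have corec₂ : Derivable ⟨[F.not.cobrec, F.cobrec], [{0, 1}], [{0, 1}, {0}, {1}]⟩ :=
    corec.step (.corecIntro [] [F.cobrec] F.not _ _ _ (by simp))
      (Cirquent.wf_pair _ _ _ (by simp) (by simp))
  have brec : Derivable ⟨[F.not.cobrec, F.cobrec.brec], [{0, 1}], [{0, 1}, {0}]⟩ :=
    corec₂.step (.recIntro [F.not.cobrec] [] F.cobrec _ [{0, 1}, {0}] [])
      (Cirquent.wf_pair _ _ _ (by simp) (by simp))
  have brec₂ : Derivable ⟨[F.not.cobrec.brec, F.cobrec.brec], [{0, 1}], [{0, 1}]⟩ :=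
    brec.step (.recIntro [] [F.cobrec.brec] F.not.cobrec _ [{0, 1}] [])
      (Cirquent.wf_pair _ _ _ (by simp) (by simp))
  rw [← dupSet_zero_singleton] at brec₂
  exact brec₂.step (.disjIntro [] [] _ _ [{0}] [{0}]) (by simp [Cirquent.WF])
end

section
/- For all formulas E, F, G, H, CL15 ⊢ ((¬E∨¬F)∧(¬G∨¬H)) ∨ ((E∨G)∧(F∨H)) (i.e., Blass's principle (E∧F)∨(G∧H) → (E∨G)∧(F∨H) is provable in CL15). -/
/-! ### Cirquents whose groups are listed explicitly -/

/-- The cirquent whose groups are given by explicit lists of positions. -/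
def Cirquent.ofLists {Atom : Type} (ofs : List (Formula Atom)) (us os : List (List ℕ)) :
    Cirquent Atom :=
  ⟨ofs, us.map fun l => {i | i ∈ l}, os.map fun l => {i | i ∈ l}⟩

/-- The listed groups are nonempty and cover exactly the positions below `n`. -/
abbrev GroupsCover (n : ℕ) (gs : List (List ℕ)) : Prop :=
  (∀ S ∈ gs, S ≠ [] ∧ ∀ i ∈ S, i < n) ∧ ∀ i < n, ∃ S ∈ gs, i ∈ S

/-- List version of `swapSet`. -/
def swapList (a : ℕ) (l : List ℕ) : List ℕ :=
  l.map fun i => if i = a then a + 1 else if i = a + 1 then a else i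

/-- List version of `dupSet`. -/
def dupList (a : ℕ) (l : List ℕ) : List ℕ :=
  l.flatMap fun i => if i < a then [i] else if i = a then [a, a + 1] else [i + 1]

theorem swapSet_setOf_mem (a : ℕ) (l : List ℕ) :
    swapSet a {i | i ∈ l} = {i | i ∈ swapList a l} := by
  ext i
  simp only [swapSet, swapList, Set.mem_ofPred_eq, List.mem_map]
  constructor
  · rintro (⟨rfl, h⟩ | ⟨rfl, h⟩ | ⟨h1, h2, h⟩)
    · exact ⟨_, h, by simp⟩
    · exact ⟨_, h, by simp⟩
    · exact ⟨_, h, by simp [h1, h2]⟩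
  · rintro ⟨j, hj, rfl⟩
    split_ifs with h1 h2
    · subst h1; simp [hj]
    · subst h2; simp [hj]
    · simp [h1, h2, hj]

theorem dupSet_setOf_mem (a : ℕ) (l : List ℕ) :
    dupSet a {i | i ∈ l} = {i | i ∈ dupList a l} := by
  ext i
  simp only [dupSet, dupList, Set.mem_ofPred_eq, List.mem_flatMap]
  constructor
  · rintro (⟨h1, h⟩ | ⟨h1, h⟩ | ⟨h1, h⟩)
    · exact ⟨_, h, by simp [h1]⟩
    · exact ⟨_, h, by simpa using h1⟩
    · refine ⟨_, h, ?_⟩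
      rw [if_neg (by omega), if_neg (by omega), List.mem_singleton]
      omega
  · rintro ⟨j, hj, h⟩
    split_ifs at h with h1 h2
    · rw [List.mem_singleton] at h
      subst h; exact .inl ⟨h1, hj⟩
    · subst h2; exact .inr (.inl ⟨by simpa using h, hj⟩)
    · rw [List.mem_singleton] at h
      subst h; exact .inr (.inr ⟨by omega, by simpa using hj⟩)

theorem setOf_mem_sdiff_singleton (a : ℕ) (l : List ℕ) :
    ({i | i ∈ l} : Set ℕ) \ {a} = {i | i ∈ l.filter (· ≠ a)} := by
  ext i
  simp

theorem setOf_mem_pair (a b : ℕ) : ({i | i ∈ [a, b]} : Set ℕ) = {a, b} := by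
  ext i
  simp

namespace Cirquent

variable {Atom : Type}

theorem wf_ofLists {ofs : List (Formula Atom)} {us os : List (List ℕ)}
    (h : 0 < ofs.length ∧ GroupsCover ofs.length us ∧ GroupsCover ofs.length os) :
    (ofLists ofs us os).WF := by
  obtain ⟨hn, ⟨hu, cu⟩, ho, co⟩ := h
  have groups : ∀ gs : List (List ℕ), (∀ S ∈ gs, S ≠ [] ∧ ∀ i ∈ S, i < ofs.length) →
      ∀ S ∈ gs.map (fun l => ({i | i ∈ l} : Set ℕ)),
        S.Nonempty ∧ ∀ i ∈ S, i < ofs.length := by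
    intro gs h S hS
    obtain ⟨l, hl, rfl⟩ := List.mem_map.1 hS
    exact ⟨List.exists_mem_of_ne_nil l (h l hl).1, (h l hl).2⟩
  have cover : ∀ gs : List (List ℕ), (∀ i < ofs.length, ∃ S ∈ gs, i ∈ S) →
      ∀ i < ofs.length, ∃ S ∈ gs.map (fun l => ({i | i ∈ l} : Set ℕ)), i ∈ S := by
    intro gs h i hi
    obtain ⟨l, hl, hil⟩ := h i hi
    exact ⟨_, List.mem_map_of_mem hl, hil⟩
  refine ⟨List.ne_nil_of_length_pos hn, ?_, ?_, groups us hu, groups os ho,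
    fun i hi => ⟨cover us cu i hi, cover os co i hi⟩⟩
  · obtain ⟨S, hS, -⟩ := cover us cu 0 hn
    exact List.ne_nil_of_mem hS
  · obtain ⟨S, hS, -⟩ := cover os co 0 hn
    exact List.ne_nil_of_mem hS

end Cirquent

/-! ### The rules of CL15 on explicitly listed groups -/

namespace Derivable

open Cirquent

variable {Atom : Type}

theorem ofLists_ax (Fs : List (Formula Atom))
    (wf : (ofLists (Fs.flatMap fun F => [F.not, F])
      ((List.range Fs.length).map fun i => [2 * i, 2 * i + 1])
      ((List.range Fs.length).map fun i => [2 * i, 2 * i + 1])).WF) :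
    Derivable (ofLists (Fs.flatMap fun F => [F.not, F])
      ((List.range Fs.length).map fun i => [2 * i, 2 * i + 1])
      ((List.range Fs.length).map fun i => [2 * i, 2 * i + 1])) := by
  refine .ax ⟨Fs, ?_, rfl, ?_, ?_⟩ wf
  · rintro rfl
    exact wf.1 rfl
  all_goals
    simp only [ofLists, List.map_map]
    exact List.map_congr_left fun i _ => setOf_mem_pair _ _

theorem ofLists_exchange (l1 l2 : List (Formula Atom)) (E F : Formula Atom)
    (us os : List (List ℕ)) (wf : (ofLists (l1 ++ [F, E] ++ l2) us os).WF)
    (h : Derivable (ofLists (l1 ++ [E, F] ++ l2)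
      (us.map (swapList l1.length)) (os.map (swapList l1.length)))) :
    Derivable (ofLists (l1 ++ [F, E] ++ l2) us os) := by
  refine .step ?_ (.ofExch l1 l2 E F _ _) wf
  simpa only [ofLists, List.map_map, Function.comp_def, swapSet_setOf_mem] using h

theorem ofLists_weaken (ofs : List (Formula Atom)) (l1 l2 : List (List ℕ)) (U U' : List ℕ)
    (os : List (List ℕ)) (a : ℕ) (wf : (ofLists ofs (l1 ++ [U] ++ l2) os).WF)
    (ha : a ∈ U ∧ (∃ b ∈ U, b ≠ a) ∧ ∃ V ∈ l1 ++ l2, a ∈ V)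
    (hU : U.filter (· ≠ a) = U') (h : Derivable (ofLists ofs (l1 ++ [U'] ++ l2) os)) :
    Derivable (ofLists ofs (l1 ++ [U] ++ l2) os) := by
  subst hU
  obtain ⟨ha, ⟨b, hb, hab⟩, V, hV, haV⟩ := ha
  simp only [ofLists, List.map_append, List.map_cons, List.map_nil] at wf h ⊢
  rw [← setOf_mem_sdiff_singleton] at h
  refine .step h (.weakenArc ofs _ _ _ a ha b hb hab ⟨{i | i ∈ V}, ?_, haV⟩ _) wf
  rw [← List.map_append]
  exact List.mem_map_of_mem hV

theorem ofLists_merge (ofs : List (Formula Atom)) (us l1 l2 : List (List ℕ))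
    (O O1 O2 : List ℕ) (wf : (ofLists ofs us (l1 ++ [O] ++ l2)).WF)
    (hO : O.Perm (O1 ++ O2))
    (h : Derivable (ofLists ofs us (l1 ++ [O1, O2] ++ l2))) :
    Derivable (ofLists ofs us (l1 ++ [O] ++ l2)) := by
  have hset : ({i | i ∈ O} : Set ℕ) = {i | i ∈ O1} ∪ {i | i ∈ O2} := by
    ext i
    simp [hO.mem_iff]
  simp only [ofLists, List.map_append, List.map_cons, List.map_nil, hset] at wf h ⊢
  exact .step h (.merging ofs _ _ _ _ _) wf

theorem ofLists_disj (l1 l2 : List (Formula Atom)) (F G : Formula Atom)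
    (us os : List (List ℕ)) (wf : (ofLists (l1 ++ [.or F G] ++ l2) us os).WF)
    (h : Derivable (ofLists (l1 ++ [F, G] ++ l2)
      (us.map (dupList l1.length)) (os.map (dupList l1.length)))) :
    Derivable (ofLists (l1 ++ [.or F G] ++ l2) us os) := by
  refine .step ?_ (.disjIntro l1 l2 F G _ _) wf
  simpa only [ofLists, List.map_map, Function.comp_def, dupSet_setOf_mem] using h

theorem ofLists_conj (l1 l2 : List (Formula Atom)) (F G : Formula Atom)
    (us os : List (List ℕ)) (wf : (ofLists (l1 ++ [.and F G] ++ l2) us os).WF)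
    (h : Derivable (ofLists (l1 ++ [F, G] ++ l2)
      (us.flatMap fun U => if l1.length ∈ U
        then [(dupList l1.length U).filter (· ≠ l1.length + 1),
          (dupList l1.length U).filter (· ≠ l1.length)]
        else [dupList l1.length U])
      (os.map (dupList l1.length)))) :
    Derivable (ofLists (l1 ++ [.and F G] ++ l2) us os) := by
  refine .step ?_ (.conjIntro l1 l2 F G _ _) wf
  convert h using 1
  simp only [ofLists, List.map_map, Function.comp_def, dupSet_setOf_mem, List.flatMap_map,
    List.map_flatMap, setOf_mem_sdiff_singleton, Set.mem_ofPred_eq]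
  congr 2
  funext U
  split_ifs <;> rfl

theorem ofLists_blass (E F G H : Formula Atom) :
    Derivable (ofLists [Formula.or
      (Formula.and (Formula.or E.not F.not) (Formula.or G.not H.not))
      (Formula.and (Formula.or E G) (Formula.or F H))] [[0]] [[0]]) := by
  refine ofLists_disj [] _ _ _ _ _ (wf_ofLists (of_decide_eq_true rfl)) ?_
  refine ofLists_conj [_] _ _ _ _ _ (wf_ofLists (of_decide_eq_true rfl)) ?_
  refine ofLists_conj [] _ _ _ _ _ (wf_ofLists (of_decide_eq_true rfl)) ?_
  change Derivable (ofLists [E.not.or F.not, G.not.or H.not, E.or G, F.or H]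
    [[0, 2], [1, 2], [0, 3], [1, 3]] [[0, 1, 2, 3]])
  refine ofLists_disj [] _ _ _ _ _ (wf_ofLists (of_decide_eq_true rfl)) ?_
  change Derivable (ofLists [E.not, F.not, G.not.or H.not, E.or G, F.or H]
    [[0, 1, 3], [2, 3], [0, 1, 4], [2, 4]] [[0, 1, 2, 3, 4]])
  refine ofLists_disj [_, _] _ _ _ _ _ (wf_ofLists (of_decide_eq_true rfl)) ?_
  change Derivable (ofLists [E.not, F.not, G.not, H.not, E.or G, F.or H]
    [[0, 1, 4], [2, 3, 4], [0, 1, 5], [2, 3, 5]] [[0, 1, 2, 3, 4, 5]])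
  refine ofLists_disj [_, _, _, _] _ _ _ _ _ (wf_ofLists (of_decide_eq_true rfl)) ?_
  change Derivable (ofLists [E.not, F.not, G.not, H.not, E, G, F.or H]
    [[0, 1, 4, 5], [2, 3, 4, 5], [0, 1, 6], [2, 3, 6]] [[0, 1, 2, 3, 4, 5, 6]])
  refine ofLists_disj [_, _, _, _, _, _] _ _ _ _ _ (wf_ofLists (of_decide_eq_true rfl)) ?_
  change Derivable (ofLists [E.not, F.not, G.not, H.not, E, G, F, H]
    [[0, 1, 4, 5], [2, 3, 4, 5], [0, 1, 6, 7], [2, 3, 6, 7]] [[0, 1, 2, 3, 4, 5, 6, 7]])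
  refine ofLists_weaken _ [] _ _ [0, 4, 5] _ 1 (wf_ofLists (of_decide_eq_true rfl))
    (of_decide_eq_true rfl) rfl ?_
  refine ofLists_weaken _ [] _ _ [0, 4] _ 5 (wf_ofLists (of_decide_eq_true rfl))
    (of_decide_eq_true rfl) rfl ?_
  refine ofLists_weaken _ [_] _ _ [2, 4, 5] _ 3 (wf_ofLists (of_decide_eq_true rfl))
    (of_decide_eq_true rfl) rfl ?_
  refine ofLists_weaken _ [_] _ _ [2, 5] _ 4 (wf_ofLists (of_decide_eq_true rfl))
    (of_decide_eq_true rfl) rfl ?_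
  refine ofLists_weaken _ [_, _] _ _ [1, 6, 7] _ 0 (wf_ofLists (of_decide_eq_true rfl))
    (of_decide_eq_true rfl) rfl ?_
  refine ofLists_weaken _ [_, _] _ _ [1, 6] _ 7 (wf_ofLists (of_decide_eq_true rfl))
    (of_decide_eq_true rfl) rfl ?_
  refine ofLists_weaken _ [_, _, _] _ _ [3, 6, 7] _ 2 (wf_ofLists (of_decide_eq_true rfl))
    (of_decide_eq_true rfl) rfl ?_
  refine ofLists_weaken _ [_, _, _] _ _ [3, 7] _ 6 (wf_ofLists (of_decide_eq_true rfl))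
    (of_decide_eq_true rfl) rfl ?_
  change Derivable (ofLists [E.not, F.not, G.not, H.not, E, G, F, H]
    [[0, 4], [2, 5], [1, 6], [3, 7]] [[0, 1, 2, 3, 4, 5, 6, 7]])
  refine ofLists_merge _ _ [] _ _ [0, 4] [2, 5, 1, 6, 3, 7] (wf_ofLists (of_decide_eq_true rfl))
    (of_decide_eq_true rfl) ?_
  refine ofLists_merge _ _ [_] _ _ [2, 5] [1, 6, 3, 7] (wf_ofLists (of_decide_eq_true rfl))
    (of_decide_eq_true rfl) ?_
  refine ofLists_merge _ _ [_, _] _ _ [1, 6] [3, 7] (wf_ofLists (of_decide_eq_true rfl))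
    (of_decide_eq_true rfl) ?_
  refine ofLists_exchange [_] _ _ _ _ _ (wf_ofLists (of_decide_eq_true rfl)) ?_
  change Derivable (ofLists [E.not, G.not, F.not, H.not, E, G, F, H]
    [[0, 4], [1, 5], [2, 6], [3, 7]] [[0, 4], [1, 5], [2, 6], [3, 7]])
  refine ofLists_exchange [_, _, _] _ _ _ _ _ (wf_ofLists (of_decide_eq_true rfl)) ?_
  change Derivable (ofLists [E.not, G.not, F.not, E, H.not, G, F, H]
    [[0, 3], [1, 5], [2, 6], [4, 7]] [[0, 3], [1, 5], [2, 6], [4, 7]])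
  refine ofLists_exchange [_, _] _ _ _ _ _ (wf_ofLists (of_decide_eq_true rfl)) ?_
  change Derivable (ofLists [E.not, G.not, E, F.not, H.not, G, F, H]
    [[0, 2], [1, 5], [3, 6], [4, 7]] [[0, 2], [1, 5], [3, 6], [4, 7]])
  refine ofLists_exchange [_] _ _ _ _ _ (wf_ofLists (of_decide_eq_true rfl)) ?_
  change Derivable (ofLists [E.not, E, G.not, F.not, H.not, G, F, H]
    [[0, 1], [2, 5], [3, 6], [4, 7]] [[0, 1], [2, 5], [3, 6], [4, 7]])
  refine ofLists_exchange [_, _, _, _] _ _ _ _ _ (wf_ofLists (of_decide_eq_true rfl)) ?_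
  change Derivable (ofLists [E.not, E, G.not, F.not, G, H.not, F, H]
    [[0, 1], [2, 4], [3, 6], [5, 7]] [[0, 1], [2, 4], [3, 6], [5, 7]])
  refine ofLists_exchange [_, _, _] _ _ _ _ _ (wf_ofLists (of_decide_eq_true rfl)) ?_
  change Derivable (ofLists [E.not, E, G.not, G, F.not, H.not, F, H]
    [[0, 1], [2, 3], [4, 6], [5, 7]] [[0, 1], [2, 3], [4, 6], [5, 7]])
  refine ofLists_exchange [_, _, _, _, _] _ _ _ _ _ (wf_ofLists (of_decide_eq_true rfl)) ?_
  change Derivable (ofLists [E.not, E, G.not, G, F.not, F, H.not, H]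
    [[0, 1], [2, 3], [4, 5], [6, 7]] [[0, 1], [2, 3], [4, 5], [6, 7]])
  exact ofLists_ax [E, G, F, H] (wf_ofLists (of_decide_eq_true rfl))

end Derivable

/-- For all formulas `E, F, G, H`,
`CL15 ⊢ ((¬E∨¬F)∧(¬G∨¬H)) ∨ ((E∨G)∧(F∨H))` (i.e., Blass's principle
`(E∧F)∨(G∧H) → (E∨G)∧(F∨H)` is provable in CL15). -/
theorem cl15_proves_blass_principle (E F G H : Formula ℕ) :
    Provable (Formula.or
      (Formula.and (Formula.or E.not F.not) (Formula.or G.not H.not))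
      (Formula.and (Formula.or E G) (Formula.or F H))) := by
  simpa [Provable, Cirquent.ofLists] using Derivable.ofLists_blass E F G H
end
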